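/- arXiv:2101.10023 — 2 statements merged into one kernel-verified Lean document; each statement's English description precedes it below -/
import Mathlib

section
/- Circle case (m = 1 after stereographic projection): let y₁,…,y_p be distinct points on the unit circle S¹ ⊂ ℝ², p ≥ 2. Then the only real solution (v₁,…,v_p) of the system Σ_{j≠i} (y_i - y_j)/|y_i - y_j|³ · v_j = 0 for all 1 ≤ i ≤ p is v₁ = ⋯ = v_p = 0. -/
/-- Abel summation: if all initial sums of `u` (in the order given by `x`) are nonnegative, then so
is the sum of `u` against a nonnegative weight that decreases along `x`. -/
theorem sum_mul_nonneg_of_initial_sums {ι : Type*} (x u : ι → ℝ) (s : Finset ι)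
    (hx : Set.InjOn x s)
    (hu : ∀ i ∈ s, 0 ≤ ∑ j ∈ s with x j ≤ x i, u j) (f : ι → ℝ)
    (hf : ∀ i ∈ s, ∀ j ∈ s, x i ≤ x j → f j ≤ f i) (hf0 : ∀ i ∈ s, 0 ≤ f i) :
    0 ≤ ∑ j ∈ s, u j * f j := by
  classical
  induction s using Finset.induction_on_max_value x generalizing f with
  | empty => simp
  | insert a s ha hmax ih =>
    have hlt : ∀ i ∈ s, x i < x a := fun i hi =>
      lt_of_le_of_ne (hmax i hi) fun h => ha <| by
        have := hx (by simp [hi]) (by simp) h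
        rwa [← this]
    have h1 : 0 ≤ ∑ j ∈ s, u j * (f j - f a) := by
      refine ih (hx.mono (by simp)) (fun i hi => ?_) (fun j => f j - f a)
        (fun i hi j hj hij => ?_) (fun i hi => ?_)
      · have := hu i (by simp [hi])
        rwa [Finset.filter_insert, if_neg (not_le.2 (hlt i hi))] at this
      · have := hf i (by simp [hi]) j (by simp [hj]) hij
        linarith
      · have := hf i (by simp [hi]) a (by simp) (hmax i hi)
        linarith
    have h2 : 0 ≤ ∑ j ∈ insert a s, u j := by
      have := hu a (by simp)
      rwa [Finset.filter_true_of_mem] at this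
      intro j hj
      rcases Finset.mem_insert.1 hj with rfl | hj
      · exact le_rfl
      · exact hmax j hj
    have h3 := mul_nonneg h2 (hf0 a (by simp))
    rw [Finset.sum_insert ha] at h3 ⊢
    have h4 : ∑ j ∈ s, u j * (f j - f a) = ∑ j ∈ s, u j * f j - (∑ j ∈ s, u j) * f a := by
      simp only [mul_sub, Finset.sum_sub_distrib, Finset.sum_mul]
    linarith

theorem sum_mul_pos_of_initial_sums {ι : Type*} (x u : ι → ℝ) (s : Finset ι)
    (hx : Set.InjOn x s)
    (hu : ∀ i ∈ s, 0 ≤ ∑ j ∈ s with x j ≤ x i, u j) (hs : 0 < ∑ j ∈ s, u j) (f : ι → ℝ)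
    (hf : ∀ i ∈ s, ∀ j ∈ s, x i ≤ x j → f j ≤ f i) (hf0 : ∀ i ∈ s, 0 < f i) :
    0 < ∑ j ∈ s, u j * f j := by
  have hne : s.Nonempty := by
    rw [Finset.nonempty_iff_ne_empty]
    rintro rfl
    simp at hs
  obtain ⟨a, ha, hmax⟩ := s.exists_max_image x hne
  have h1 := sum_mul_nonneg_of_initial_sums x u s hx hu (fun j => f j - f a)
    (fun i hi j hj hij => by
      have := hf i hi j hj hij
      simpa using this)
    (fun i hi => by
      have := hf i hi a ha (hmax i hi)
      simpa using this)
  have h2 := mul_pos hs (hf0 a ha)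
  have h3 : ∑ j ∈ s, u j * (f j - f a) = ∑ j ∈ s, u j * f j - (∑ j ∈ s, u j) * f a := by
    simp only [mul_sub, Finset.sum_sub_distrib, Finset.sum_mul]
  linarith

/-- Convexity of the inverse square: its increments decrease along the half-line. -/
theorem inv_sq_sub_inv_sq_antitone {a b d : ℝ} (ha : 0 < a) (hab : a ≤ b) (hd : 0 ≤ d) :
    1 / b ^ 2 - 1 / (b + d) ^ 2 ≤ 1 / a ^ 2 - 1 / (a + d) ^ 2 := by
  have key : ∀ c : ℝ, 0 < c →
      1 / c ^ 2 - 1 / (c + d) ^ 2 = d * ((1 / c + 1 / (c + d)) * (1 / (c * (c + d)))) := by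
    intro c hc
    have : 0 < c + d := by linarith
    field_simp
    ring
  have hb : 0 < b := ha.trans_le hab
  rw [key a ha, key b hb]
  gcongr

/-- Two separated groups of charges whose cumulative sums, counted from the gap, have fixed signs
interact with a definite sign. -/
theorem sum_sum_inv_sq_pos {ι : Type*} (x u w : ι → ℝ) (s t : Finset ι) (hs : Set.InjOn x s)
    (ht : Set.InjOn x t) (hst : ∀ i ∈ s, ∀ j ∈ t, x i < x j)
    (hu : ∀ i ∈ s, 0 ≤ ∑ j ∈ s with x i ≤ x j, u j) (hu0 : 0 < ∑ j ∈ s, u j)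
    (hw : ∀ i ∈ t, 0 ≤ ∑ j ∈ t with x j ≤ x i, w j) (hw0 : 0 < ∑ j ∈ t, w j) :
    0 < ∑ i ∈ s, u i * ∑ j ∈ t, w j * (1 / (x j - x i) ^ 2) := by
  refine sum_mul_pos_of_initial_sums (fun i => -x i) u s
    (fun i hi j hj hij => hs hi hj (neg_injective hij)) (by simpa using hu) hu0 _ ?_ ?_
  · intro i hi k hk hik
    have hki : x k ≤ x i := by linarith
    have h := sum_mul_nonneg_of_initial_sums x w t ht hw
      (fun j => 1 / (x j - x i) ^ 2 - 1 / (x j - x k) ^ 2) ?_ ?_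
    · simp only [mul_sub, Finset.sum_sub_distrib] at h
      linarith
    · intro j hj l hl hjl
      have := inv_sq_sub_inv_sq_antitone (a := x j - x i) (b := x l - x i) (d := x i - x k)
        (by linarith [hst i hi j hj]) (by linarith) (by linarith)
      simpa using this
    · intro j hj
      have h1 : 0 < x j - x i := by linarith [hst i hi j hj]
      have : 1 / (x j - x k) ^ 2 ≤ 1 / (x j - x i) ^ 2 := by gcongr
      linarith
  · intro i hi
    refine sum_mul_pos_of_initial_sums x w t ht hw hw0 _ ?_ ?_
    · intro j hj l hl hjl
      have h1 : 0 < x j - x i := by linarith [hst i hi j hj]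
      gcongr
    · intro j hj
      have h1 : 0 < x j - x i := by linarith [hst i hi j hj]
      positivity

/-- A neutral system of charges on the line with all Coulomb forces zero has no positive
cumulative charge. -/
theorem cumulative_sum_nonpos_of_equilibrium {ι : Type*} (x u : ι → ℝ) (s : Finset ι)
    (hx : Set.InjOn x s) (hsum : ∑ j ∈ s, u j = 0)
    (heq : ∀ i ∈ s, ∑ j ∈ s, u j * ((x i - x j) / |x i - x j| ^ 3) = 0) :
    ∀ i ∈ s, ∑ j ∈ s with x j ≤ x i, u j ≤ 0 := by
  classical
  by_contra! hpos
  obtain ⟨i₀, hi₀, hi₀pos⟩ := hpos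
  obtain ⟨m, hm, hmax⟩ := s.exists_max_image (fun i => ∑ j ∈ s with x j ≤ x i, u j) ⟨i₀, hi₀⟩
  have hM : 0 < ∑ j ∈ s with x j ≤ x m, u j := hi₀pos.trans_le (hmax i₀ hi₀)
  have hsplit : ∑ j ∈ s with x j ≤ x m, u j + ∑ j ∈ s with ¬ x j ≤ x m, u j = 0 := by
    rw [Finset.sum_filter_add_sum_filter_not, hsum]
  have hlt : ∀ i ∈ s, ∑ j ∈ s with x j < x i, u j ≤ ∑ j ∈ s with x j ≤ x m, u j := by
    intro i hi
    rcases (s.filter fun j => x j < x i).eq_empty_or_nonempty with h | h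
    · rw [h]
      simpa using hM.le
    · obtain ⟨k, hk, hkmax⟩ := Finset.exists_max_image _ x h
      rw [Finset.mem_filter] at hk
      have : (s.filter fun j => x j < x i) = s.filter fun j => x j ≤ x k := by
        ext j
        simp only [Finset.mem_filter]
        exact ⟨fun hj => ⟨hj.1, hkmax j (by simpa using hj)⟩, fun hj => ⟨hj.1, hj.2.trans_lt hk.2⟩⟩
      rw [this]
      exact hmax k hk.1
  have hpos := sum_sum_inv_sq_pos x u (fun j => -u j) (s.filter fun j => x j ≤ x m)
    (s.filter fun j => ¬ x j ≤ x m) (hx.mono (Finset.coe_subset.2 (Finset.filter_subset _ _))) (hx.mono (Finset.coe_subset.2 (Finset.filter_subset _ _)))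
    (fun i hi j hj => by
      simp only [Finset.mem_filter, not_le] at hi hj
      linarith [hi.2, hj.2])
    (fun i hi => by
      rw [Finset.mem_filter] at hi
      have h1 := hlt i hi.1
      rw [← Finset.sum_filter_add_sum_filter_not (s.filter fun j => x j ≤ x m)
        (fun j => x i ≤ x j)] at h1
      have : ((s.filter fun j => x j ≤ x m).filter fun j => ¬ x i ≤ x j)
          = s.filter fun j => x j < x i := by
        ext j
        simp only [Finset.mem_filter, not_le]
        exact ⟨fun h => ⟨h.1.1, h.2⟩, fun h => ⟨⟨h.1, by linarith [h.2, hi.2]⟩, h.2⟩⟩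
      rw [this] at h1
      linarith)
    hM
    (fun i hi => by
      rw [Finset.mem_filter] at hi
      have h1 := hmax i hi.1
      rw [← Finset.sum_filter_add_sum_filter_not (s.filter fun j => x j ≤ x i)
        (fun j => x j ≤ x m), Finset.filter_filter, Finset.filter_filter] at h1
      have h2 : (s.filter fun j => x j ≤ x i ∧ x j ≤ x m) = s.filter fun j => x j ≤ x m := by
        ext j
        simp only [Finset.mem_filter]
        exact ⟨fun h => ⟨h.1, h.2.2⟩, fun h => ⟨h.1, by linarith [h.2, not_le.1 hi.2], h.2⟩⟩
      rw [h2] at h1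
      rw [Finset.filter_filter, Finset.sum_neg_distrib]
      simp only [and_comm] at h1 ⊢
      linarith)
    (by
      rw [Finset.sum_neg_distrib]
      linarith)
  set L := s.filter fun j => x j ≤ x m with hL
  set R := s.filter fun j => ¬ x j ≤ x m with hR
  have hRR : ∑ i ∈ R, ∑ j ∈ R, u i * (u j * ((x i - x j) / |x i - x j| ^ 3)) = 0 := by
    have h : ∑ i ∈ R, ∑ j ∈ R, u i * (u j * ((x i - x j) / |x i - x j| ^ 3))
        = -∑ i ∈ R, ∑ j ∈ R, u i * (u j * ((x i - x j) / |x i - x j| ^ 3)) := by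
      conv_lhs => rw [Finset.sum_comm]
      simp only [← Finset.sum_neg_distrib]
      refine Finset.sum_congr rfl fun i _ => Finset.sum_congr rfl fun j _ => ?_
      rw [abs_sub_comm (x j) (x i)]
      ring
    linarith
  have hRL : ∑ i ∈ R, ∑ j ∈ L, u i * (u j * ((x i - x j) / |x i - x j| ^ 3)) = 0 := by
    have h : ∑ i ∈ R, u i * ∑ j ∈ s, u j * ((x i - x j) / |x i - x j| ^ 3) = 0 :=
      Finset.sum_eq_zero fun i hi => by
        rw [heq i (Finset.mem_of_mem_filter i hi), mul_zero]
    simp only [← Finset.sum_filter_add_sum_filter_not s (fun j => x j ≤ x m), ← hL, ← hR,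
      mul_add, Finset.sum_add_distrib, Finset.mul_sum] at h
    linarith
  rw [Finset.sum_comm] at hRL
  have : ∑ i ∈ L, u i * ∑ j ∈ R, -u j * (1 / (x j - x i) ^ 2)
      = -∑ j ∈ L, ∑ i ∈ R, u i * (u j * ((x i - x j) / |x i - x j| ^ 3)) := by
    simp only [← Finset.sum_neg_distrib, Finset.mul_sum]
    refine Finset.sum_congr rfl fun i hi => Finset.sum_congr rfl fun j hj => ?_
    have h1 : 0 < x j - x i := by
      have h2 := (Finset.mem_filter.1 hi).2
      have h3 := not_le.1 (Finset.mem_filter.1 hj).2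
      linarith
    rw [abs_of_pos h1]
    field_simp
  rw [this, hRL, neg_zero] at hpos
  exact lt_irrefl _ hpos

/-- A neutral system of charges on the line with all Coulomb forces zero is trivial. -/
theorem eq_zero_of_neutral_equilibrium {ι : Type*} (x u : ι → ℝ) (s : Finset ι)
    (hx : Set.InjOn x s) (hsum : ∑ j ∈ s, u j = 0)
    (heq : ∀ i ∈ s, ∑ j ∈ s, u j * ((x i - x j) / |x i - x j| ^ 3) = 0) :
    ∀ i ∈ s, u i = 0 := by
  classical
  have h1 := cumulative_sum_nonpos_of_equilibrium x u s hx hsum heq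
  have h2 := cumulative_sum_nonpos_of_equilibrium x (fun j => -u j) s hx
    (by rw [Finset.sum_neg_distrib, hsum, neg_zero])
    (fun i hi => by simp only [neg_mul, Finset.sum_neg_distrib, heq i hi, neg_zero])
  by_contra! hne
  obtain ⟨i₀, hi₀, hi₀ne⟩ := hne
  obtain ⟨k, hk, hkmin⟩ := Finset.exists_min_image (s.filter fun i => u i ≠ 0) x
    ⟨i₀, Finset.mem_filter.2 ⟨hi₀, hi₀ne⟩⟩
  rw [Finset.mem_filter] at hk
  have h3 : ∑ j ∈ s with x j ≤ x k, u j = u k := by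
    refine Finset.sum_eq_single_of_mem k (by simp [hk.1]) fun j hj hjk => ?_
    rw [Finset.mem_filter] at hj
    by_contra hj0
    exact hjk (hx hj.1 hk.1 (le_antisymm hj.2 (hkmin j (Finset.mem_filter.2 ⟨hj.1, hj0⟩))))
  have h4 := h1 k hk.1
  have h5 := h2 k hk.1
  rw [Finset.sum_neg_distrib] at h5
  rw [h3] at h4 h5
  exact hk.2 (by linarith)

open Finset in
theorem stmt_8 (p : ℕ) (hp : 2 ≤ p) (y : Fin p → EuclideanSpace ℝ (Fin 2))
    (hinj : Function.Injective y) (hnorm : ∀ i, ‖y i‖ = 1)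
    (v : Fin p → ℝ)
    (h : ∀ i, ∑ j ∈ univ \ {i}, (v j / ‖y i - y j‖ ^ 3) • (y i - y j) = 0) :
    v = 0 := by
  have hunit : ∀ i, y i 0 ^ 2 + y i 1 ^ 2 = 1 := by
    intro i
    have := EuclideanSpace.norm_sq_eq (y i)
    rw [hnorm i] at this
    simpa [Fin.sum_univ_two] using this.symm
  have hdist : ∀ i j, ‖y i - y j‖ ^ 2 = (y i 0 - y j 0) ^ 2 + (y i 1 - y j 1) ^ 2 := by
    intro i j
    simp [EuclideanSpace.norm_sq_eq, Fin.sum_univ_two]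
  have hcoord : ∀ i c, ∑ j ∈ univ \ {i}, v j / ‖y i - y j‖ ^ 3 * (y i c - y j c) = 0 := by
    intro i c
    have := congrArg (fun z : EuclideanSpace ℝ (Fin 2) => z c) (h i)
    simpa using this
  have hpos : ∀ i j, i ≠ j → 0 < ‖y i - y j‖ := fun i j hij =>
    norm_pos_iff.2 (sub_ne_zero.2 fun h => hij (hinj h))
  funext n
  obtain ⟨k, hk⟩ : ∃ k : Fin p, k ≠ n := by
    have : Nontrivial (Fin p) := Fin.nontrivial_iff_two_le.2 hp
    exact exists_ne n
  set ρ : Fin p → ℝ := fun j => ‖y k - y j‖ with hρ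
  set x : Fin p → ℝ := fun j => (y j 1 * y k 0 - y j 0 * y k 1) / (ρ j ^ 2 / 2) with hxdef
  have hρpos : ∀ j, j ≠ k → 0 < ρ j := fun j hj => hpos k j hj.symm
  have hρsq : ∀ j, ρ j ^ 2 / 2 = 1 - (y j 0 * y k 0 + y j 1 * y k 1) := by
    intro j
    simp only [hρ, hdist]
    linear_combination (hunit k + hunit j) / 2
  have hxρ : ∀ j, j ≠ k → x j * (ρ j ^ 2 / 2) = y j 1 * y k 0 - y j 0 * y k 1 := by
    intro j hj
    have := hρpos j hj
    simp only [hxdef]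
    field_simp
  have hdiff : ∀ i j, i ≠ k → j ≠ k → (x i - x j) * (ρ i ^ 2 / 2) * (ρ j ^ 2 / 2)
      = (y i 0 - y j 0) * (y i 1 - y k 1) - (y i 1 - y j 1) * (y i 0 - y k 0) := by
    intro i j hi hj
    have e1 := hxρ i hi
    have e2 := hxρ j hj
    rw [show (x i - x j) * (ρ i ^ 2 / 2) * (ρ j ^ 2 / 2)
      = (x i * (ρ i ^ 2 / 2)) * (ρ j ^ 2 / 2) - (x j * (ρ j ^ 2 / 2)) * (ρ i ^ 2 / 2) by ring,
      e1, e2, hρsq, hρsq]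
    linear_combination (y i 0 * y j 1 - y i 1 * y j 0) * hunit k
  have hN2 : ∀ i j, i ≠ k → j ≠ k →
      ‖y i - y j‖ ^ 2 = (|x i - x j| * ρ i * ρ j / 2) ^ 2 := by
    intro i j hi hj
    have hi' := hρpos i hi
    have hj' := hρpos j hj
    have e1 := hdiff i j hi hj
    have e2 : ((y i 0 - y j 0) * (y i 1 - y k 1) - (y i 1 - y j 1) * (y i 0 - y k 0)) ^ 2
        = (ρ i ^ 2 / 2) * (ρ j ^ 2 / 2) * ‖y i - y j‖ ^ 2 := by
      have hst : ∀ l, (ρ l ^ 2 / 2) ^ 2 + (y l 1 * y k 0 - y l 0 * y k 1) ^ 2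
          = 2 * (ρ l ^ 2 / 2) := by
        intro l
        rw [hρsq]
        linear_combination (y k 0 ^ 2 + y k 1 ^ 2) * hunit l + hunit k
      have hNst : ‖y i - y j‖ ^ 2 = 2 * (ρ i ^ 2 / 2) + 2 * (ρ j ^ 2 / 2)
          - 2 * ((ρ i ^ 2 / 2) * (ρ j ^ 2 / 2))
          - 2 * ((y i 1 * y k 0 - y i 0 * y k 1) * (y j 1 * y k 0 - y j 0 * y k 1)) := by
        rw [hρsq, hρsq, hdist]
        linear_combination hunit i + hunit j + 2 * (y i 0 * y j 0 + y i 1 * y j 1) * hunit k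
      rw [hNst, ← e1, show (x i - x j) * (ρ i ^ 2 / 2) * (ρ j ^ 2 / 2)
        = (x i * (ρ i ^ 2 / 2)) * (ρ j ^ 2 / 2) - (x j * (ρ j ^ 2 / 2)) * (ρ i ^ 2 / 2) by ring,
        hxρ i hi, hxρ j hj]
      linear_combination (ρ j ^ 2 / 2) ^ 2 * hst i + (ρ i ^ 2 / 2) ^ 2 * hst j
    rw [← e1] at e2
    have e3 : (|x i - x j| * ρ i * ρ j / 2) ^ 2 = (x i - x j) ^ 2 * ρ i ^ 2 * ρ j ^ 2 / 4 := by
      rw [div_pow, mul_pow, mul_pow, sq_abs]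
      norm_num
    rw [e3]
    have h0 : (ρ i ^ 2 / 2) * (ρ j ^ 2 / 2) ≠ 0 := by positivity
    apply mul_left_cancel₀ h0
    rw [← e2]
    ring
  have hN : ∀ i j, i ≠ k → j ≠ k → ‖y i - y j‖ = |x i - x j| * ρ i * ρ j / 2 := by
    intro i j hi hj
    have hi' := hρpos i hi
    have hj' := hρpos j hj
    exact (sq_eq_sq₀ (norm_nonneg _) (by positivity)).1 (hN2 i j hi hj)
  have hxinj : Set.InjOn x (univ \ {k} : Finset (Fin p)) := by
    intro i hi j hj hij
    by_contra hne
    have := hpos i j hne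
    rw [hN i j (by simpa using hi) (by simpa using hj), hij] at this
    simp at this
  have hmain := eq_zero_of_neutral_equilibrium x (fun j => v j / ρ j) (univ \ {k}) hxinj ?_ ?_ n
    (by simpa using hk.symm)
  · have := hρpos n hk.symm
    simpa [this.ne'] using hmain
  · have e0 := hcoord k 0
    have e1 := hcoord k 1
    have e2 : ∑ j ∈ univ \ {k}, v j / ρ j
        = 2 * (y k 0 * ∑ j ∈ univ \ {k}, v j / ‖y k - y j‖ ^ 3 * (y k 0 - y j 0)
          + y k 1 * ∑ j ∈ univ \ {k}, v j / ‖y k - y j‖ ^ 3 * (y k 1 - y j 1)) := by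
      rw [mul_sum, mul_sum, ← sum_add_distrib, mul_sum]
      refine sum_congr rfl fun j hj => ?_
      have hj' := hρpos j (by simpa using hj)
      have e3 := hρsq j
      change v j / ρ j = 2 * (y k 0 * (v j / ρ j ^ 3 * _) + y k 1 * (v j / ρ j ^ 3 * _))
      have e4 : y k 0 * (y k 0 - y j 0) + y k 1 * (y k 1 - y j 1) = ρ j ^ 2 / 2 := by
        rw [e3]
        linear_combination hunit k
      calc v j / ρ j = 2 * (v j / ρ j ^ 3 * (ρ j ^ 2 / 2)) := by field_simp
        _ = _ := by
          rw [← e4]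
          ring
    rw [e2, e0, e1]
    simp
  · intro i hi
    have hi : i ≠ k := by simpa using hi
    have hi' := hρpos i hi
    have e0 := hcoord i 0
    have e1 := hcoord i 1
    have e2 : ∑ j ∈ univ \ {i}, v j / ‖y i - y j‖ ^ 3 *
        ((y i 0 - y j 0) * (y i 1 - y k 1) - (y i 1 - y j 1) * (y i 0 - y k 0)) = 0 := by
      have : ∀ j, v j / ‖y i - y j‖ ^ 3 *
        ((y i 0 - y j 0) * (y i 1 - y k 1) - (y i 1 - y j 1) * (y i 0 - y k 0))
        = v j / ‖y i - y j‖ ^ 3 * (y i 0 - y j 0) * (y i 1 - y k 1)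
          - v j / ‖y i - y j‖ ^ 3 * (y i 1 - y j 1) * (y i 0 - y k 0) := fun j => by ring
      simp only [this, sum_sub_distrib, ← sum_mul, e0, e1]
      simp
    rw [sum_subset (subset_univ _) (by
      intro j _ hj
      obtain rfl : j = i := by simpa using hj
      simp)] at e2
    rw [← sum_subset (subset_univ (univ \ {k})) (by
      intro j _ hj
      obtain rfl : j = k := by simpa using hj
      ring)] at e2
    have e3 : ∑ j ∈ univ \ {k}, v j / ρ j * ((x i - x j) / |x i - x j| ^ 3)
        = ρ i / 2 * ∑ j ∈ univ \ {k}, v j / ‖y i - y j‖ ^ 3 *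
          ((y i 0 - y j 0) * (y i 1 - y k 1) - (y i 1 - y j 1) * (y i 0 - y k 0)) := by
      rw [mul_sum]
      refine sum_congr rfl fun j hj => ?_
      have hj : j ≠ k := by simpa using hj
      have hj' := hρpos j hj
      rw [← hdiff i j hi hj, hN i j hi hj]
      rcases eq_or_ne (x i - x j) 0 with h0 | h0
      · simp [h0]
      · have := abs_pos.2 h0
        field_simp
    rw [e3, e2, mul_zero]
end

section
/- Bahri–Xu conjecture for p = 4: there exists a constant c > 0 such that for any distinct x₁, x₂, x₃, x₄ ∈ ℝᵐ and any u ∈ ℝ⁴, Σ_{i=1}^4 |Σ_{j≠i} u_j/|x_i-x_j||² + 2 max_{1≤i≤4} |Σ_{j≠i} u_i u_j (x_i-x_j)/|x_i-x_j|³| ≥ c · Σ_{i≠j} u_j²/|x_i-x_j|². -/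
open Filter Topology

/-- The one-dimensional inverse-square force `s ↦ s / |s|³`. -/
noncomputable def invSqForce (s : ℝ) : ℝ := s / |s| ^ 3

lemma invSqForce_mul (s t : ℝ) : invSqForce (s * t) = invSqForce s * invSqForce t := by
  simp only [invSqForce, abs_mul, mul_pow]
  rw [mul_div_mul_comm]

lemma invSqForce_neg (s : ℝ) : invSqForce (-s) = -invSqForce s := by
  simp [invSqForce, neg_div]

lemma invSqForce_of_pos {s : ℝ} (hs : 0 < s) : invSqForce s = (s ^ 2)⁻¹ := by
  rw [invSqForce, abs_of_pos hs]; field_simp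

lemma invSqForce_pos {s : ℝ} (hs : 0 < s) : 0 < invSqForce s := by
  rw [invSqForce_of_pos hs]; positivity

lemma invSqForce_add_lt {s t : ℝ} (hs : 0 < s) (ht : 0 < t) :
    invSqForce (s + t) < invSqForce s + invSqForce t := by
  have h : invSqForce (s + t) < invSqForce s := by
    rw [invSqForce_of_pos hs, invSqForce_of_pos (add_pos hs ht)]
    gcongr
    linarith
  linarith [invSqForce_pos ht]

lemma invSqForce_add_ne {s t : ℝ} (hs : s ≠ 0) (ht : t ≠ 0) (hst : s + t ≠ 0) :
    invSqForce (s + t) ≠ invSqForce s + invSqForce t := by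
  intro h
  have h' : ∀ a, invSqForce (-a) = -invSqForce a := invSqForce_neg
  rcases lt_or_gt_of_ne hs with hs | hs <;> rcases lt_or_gt_of_ne ht with ht | ht
  · have := invSqForce_add_lt (neg_pos.mpr hs) (neg_pos.mpr ht)
    rw [← neg_add, h', h', h'] at this
    linarith
  · rcases lt_or_gt_of_ne hst with hst | hst
    · have := invSqForce_add_lt (neg_pos.mpr hst) ht
      rw [show -(s + t) + t = -s by ring, h', h'] at this
      linarith
    · have := invSqForce_add_lt (neg_pos.mpr hs) hst
      rw [show -s + (s + t) = t by ring, h'] at this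
      linarith
  · rcases lt_or_gt_of_ne hst with hst | hst
    · have := invSqForce_add_lt (neg_pos.mpr hst) hs
      rw [show -(s + t) + s = -t by ring, h', h'] at this
      linarith
    · have := invSqForce_add_lt (neg_pos.mpr ht) hst
      rw [show -t + (s + t) = s by ring, h'] at this
      linarith
  · exact (invSqForce_add_lt hs ht).ne h

lemma eq_zero_of_three_potentials {a b c p q r : ℝ} (ha : 0 < a) (hb : 0 < b) (hc : 0 < c)
    (h₁ : q * a + r * b = 0) (h₂ : p * a + r * c = 0) (h₃ : p * b + q * c = 0) :
    p = 0 ∧ q = 0 ∧ r = 0 := by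
  have hr : r = 0 := by
    have : (2 * b * c) * r = 0 := by linear_combination c * h₁ + b * h₂ - a * h₃
    simpa [hb.ne', hc.ne'] using this
  subst hr
  refine ⟨?_, ?_, rfl⟩
  · simpa [ha.ne'] using h₂
  · simpa [ha.ne'] using h₁

variable {E : Type*} [NormedAddCommGroup E] [NormedSpace ℝ E]

/-- The potential at the `i`-th point of the charges `u` placed at the points `x`. -/
noncomputable def potential {ι : Type*} [Fintype ι] (x : ι → E) (u : ι → ℝ) (i : ι) : ℝ :=
  ∑ j, u j / ‖x i - x j‖

/-- The force on the `i`-th of the charges `u` placed at the points `x`. -/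
noncomputable def force {ι : Type*} [Fintype ι] (x : ι → E) (u : ι → ℝ) (i : ι) : E :=
  ∑ j, (u i * u j / ‖x i - x j‖ ^ 3) • (x i - x j)

lemma force_collinear {ι : Type*} [Fintype ι] {x : ι → E} {u t : ι → ℝ} {o p : E}
    (hp : p ≠ 0) (hx : ∀ i, x i = o + t i • p) {i : ι} (hi : u i ≠ 0) (h : force x u i = 0) :
    ∑ j, u j * invSqForce (t i - t j) = 0 := by
  have key : force x u i =
      ((u i / ‖p‖ ^ 3) * ∑ j, u j * invSqForce (t i - t j)) • p := by
    rw [Finset.mul_sum, Finset.sum_smul]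
    refine Finset.sum_congr rfl fun j _ => ?_
    have : x i - x j = (t i - t j) • p := by rw [hx, hx]; module
    rw [this, norm_smul, smul_smul, Real.norm_eq_abs, invSqForce, mul_pow]
    congr 1
    ring
  rw [h, eq_comm, smul_eq_zero_iff_left hp] at key
  have : u i / ‖p‖ ^ 3 ≠ 0 := div_ne_zero hi (by simpa using hp)
  simpa [this] using key

lemma potential_collinear {ι : Type*} [Fintype ι] {x : ι → E} {u t : ι → ℝ} {o p : E}
    (hx : ∀ i, x i = o + t i • p) (i : ι) :
    potential x u i = (∑ j, u j * ((t i - t j) * invSqForce (t i - t j))) / ‖p‖ := by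
  rw [Finset.sum_div]
  refine Finset.sum_congr rfl fun j _ => ?_
  have : x i - x j = (t i - t j) • p := by rw [hx, hx]; module
  rw [this, norm_smul, Real.norm_eq_abs, invSqForce]
  rcases eq_or_ne (t i - t j) 0 with h | h
  · simp [h]
  · have h' : |t i - t j| ≠ 0 := abs_ne_zero.mpr h
    have e : (t i - t j) * ((t i - t j) / |t i - t j| ^ 3) = |t i - t j|⁻¹ := by
      field_simp
      rw [sq_abs]
    rw [e, div_mul_eq_div_div, div_eq_mul_inv (u j)]

lemma exists_eq_zero_of_force_collinear_four {x : Fin 4 → E} {u t : Fin 4 → ℝ} {o p : E}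
    (hinj : Function.Injective x) (hx : ∀ i, x i = o + t i • p)
    (hF : ∀ i, force x u i = 0) : ∃ i, u i = 0 := by
  by_contra! hu
  have hp : p ≠ 0 := by
    rintro rfl
    exact absurd (@hinj 0 1 (by rw [hx, hx]; simp)) (by decide)
  have ht : ∀ i j, i ≠ j → t i - t j ≠ 0 := fun i j hij h =>
    hij (hinj (by rw [hx, hx, sub_eq_zero.mp h]))
  have h := fun i => force_collinear hp hx (hu i) (hF i)
  have hs : ∀ i j, invSqForce (t i - t j) = -invSqForce (t j - t i) := fun i j => by
    rw [← invSqForce_neg, neg_sub]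
  have h0 := h 0
  have h1 := h 1
  have h2 := h 2
  have hz : invSqForce 0 = 0 := by simp [invSqForce]
  simp only [Fin.sum_univ_four, sub_self, hz] at h0 h1 h2
  rw [hs 1 0] at h1
  rw [hs 2 0, hs 2 1] at h2
  have pf : (invSqForce ((t 0 - t 1) * (t 2 - t 3)) + invSqForce ((t 1 - t 2) * (t 0 - t 3))
      - invSqForce ((t 0 - t 2) * (t 1 - t 3))) * u 3 = 0 := by
    simp only [invSqForce_mul]
    linear_combination invSqForce (t 1 - t 2) * h0 - invSqForce (t 0 - t 2) * h1
      + invSqForce (t 0 - t 1) * h2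
  have e : (t 0 - t 2) * (t 1 - t 3) = (t 0 - t 1) * (t 2 - t 3) + (t 1 - t 2) * (t 0 - t 3) := by
    ring
  refine invSqForce_add_ne (mul_ne_zero (ht 0 1 (by decide)) (ht 2 3 (by decide)))
    (mul_ne_zero (ht 1 2 (by decide)) (ht 0 3 (by decide))) ?_ ?_
  · rw [← e]
    exact mul_ne_zero (ht 0 2 (by decide)) (ht 1 3 (by decide))
  · rw [← e]
    have := (mul_eq_zero.mp pf).resolve_right (hu 3)
    linarith

lemma stress_minors_eq {x : Fin 4 → E} (hli : LinearIndependent ℝ ![x 1 - x 0, x 2 - x 0])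
    {a b c d e f : ℝ}
    (h₀ : a • (x 0 - x 1) + b • (x 0 - x 2) + c • (x 0 - x 3) = 0)
    (h₁ : a • (x 1 - x 0) + d • (x 1 - x 2) + e • (x 1 - x 3) = 0)
    (h₂ : b • (x 2 - x 0) + d • (x 2 - x 1) + f • (x 2 - x 3) = 0) :
    a * f = c * d ∧ b * e = c * d := by
  rw [LinearIndependent.pair_iff] at hli
  constructor
  · have := (hli (a * f - c * d) (b * f + c * (b + d + f)) (by
      linear_combination (norm := module) (-f) • h₀ + c • h₂)).1
    linarith
  · have := (hli (a * e + c * (a + d + e)) (b * e - c * d) (by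
      linear_combination (norm := module) (-e) • h₀ + c • h₁)).2
    linarith

lemma eq_zero_of_potential_of_products_eq {a b c d e f u₀ u₁ u₂ u₃ : ℝ} (ha : 0 < a) (hb : 0 < b)
    (hc : 0 < c) (he : 0 < e) (h₁ : a * f = c * d) (h₂ : b * e = c * d)
    (p₀ : u₁ * a + u₂ * b + u₃ * c = 0) (p₁ : u₀ * a + u₂ * d + u₃ * e = 0)
    (p₂ : u₀ * b + u₁ * d + u₃ * f = 0) (p₃ : u₀ * c + u₁ * e + u₂ * f = 0) : u₀ = 0 := by
  have k₁ : u₁ * d = u₀ * b := by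
    have : (a * e) * (u₁ * d - u₀ * b) = 0 := by
      linear_combination d * e * p₀ - c * d * p₁ - d * u₂ * h₂ - u₀ * a * h₂
    have := (mul_eq_zero.mp this).resolve_left (by positivity)
    linarith
  have k₃ : u₃ * f = u₀ * b := by
    have : (c * e) * (u₃ * f - u₀ * b) = 0 := by
      linear_combination e * f * p₀ - a * f * p₃ - u₂ * f * (h₂ - h₁) + u₀ * c * (h₁ - h₂)
    have := (mul_eq_zero.mp this).resolve_left (by positivity)
    linarith
  have : u₀ * b = 0 := by linarith
  simpa [hb.ne'] using this

lemma eq_zero_of_potential_of_force_four {x : Fin 4 → E} {u : Fin 4 → ℝ}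
    (hinj : Function.Injective x) (hP : ∀ i, potential x u i = 0)
    (hF : ∀ i, force x u i = 0) (i : Fin 4) : u i = 0 := by
  have hpos : ∀ i j, i ≠ j → 0 < ‖x i - x j‖⁻¹ := fun i j hij =>
    inv_pos.mpr (norm_sub_pos_iff.mpr (hinj.ne hij))
  have p01 := hpos 0 1 (by decide)
  have p02 := hpos 0 2 (by decide)
  have p03 := hpos 0 3 (by decide)
  have p12 := hpos 1 2 (by decide)
  have p13 := hpos 1 3 (by decide)
  have p23 := hpos 2 3 (by decide)
  have P0 := hP 0
  have P1 := hP 1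
  have P2 := hP 2
  have P3 := hP 3
  have F0 := hF 0
  have F1 := hF 1
  have F2 := hF 2
  have r10 := norm_sub_rev (x 1) (x 0)
  have r20 := norm_sub_rev (x 2) (x 0)
  have r30 := norm_sub_rev (x 3) (x 0)
  have r21 := norm_sub_rev (x 2) (x 1)
  have r31 := norm_sub_rev (x 3) (x 1)
  have r32 := norm_sub_rev (x 3) (x 2)
  simp only [potential, force, Fin.sum_univ_four, r10, r20, r30, r21, r31, r32, sub_self, norm_zero,
    inv_zero, mul_zero, smul_zero, zero_add, add_zero, div_eq_mul_inv, ← inv_pow]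
    at P0 P1 P2 P3 F0 F1 F2
  clear hpos r10 r20 r30 r21 r31 r32
  generalize ‖x 0 - x 1‖⁻¹ = a at *
  generalize ‖x 0 - x 2‖⁻¹ = b at *
  generalize ‖x 0 - x 3‖⁻¹ = c at *
  generalize ‖x 1 - x 2‖⁻¹ = d at *
  generalize ‖x 1 - x 3‖⁻¹ = e at *
  generalize ‖x 2 - x 3‖⁻¹ = f at *
  suffices h : u 0 = 0 ∨ u 1 = 0 ∨ u 2 = 0 ∨ u 3 = 0 by
    have all : u 0 = 0 ∧ u 1 = 0 ∧ u 2 = 0 ∧ u 3 = 0 := by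
      rcases h with h | h | h | h <;> simp only [h, zero_mul, zero_add, add_zero] at P0 P1 P2 P3
      · exact ⟨h, eq_zero_of_three_potentials p12 p13 p23 P1 P2 P3⟩
      · obtain ⟨h1, h2, h3⟩ := eq_zero_of_three_potentials p02 p03 p23 P0 P2 P3
        exact ⟨h1, h, h2, h3⟩
      · obtain ⟨h1, h2, h3⟩ := eq_zero_of_three_potentials p01 p03 p13 P0 P1 P3
        exact ⟨h1, h2, h, h3⟩
      · obtain ⟨h1, h2, h3⟩ := eq_zero_of_three_potentials p01 p02 p12 P0 P1 P2
        exact ⟨h1, h2, h3, h⟩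
    obtain ⟨h0, h1, h2, h3⟩ := all
    fin_cases i <;> assumption
  by_contra! hu
  obtain ⟨u0, u1, u2, u3⟩ := hu
  have hx10 : x 1 - x 0 ≠ 0 := sub_ne_zero.mpr (hinj.ne (by decide))
  by_cases hli : LinearIndependent ℝ ![x 1 - x 0, x 2 - x 0]
  · rw [mul_comm (u 1) (u 0)] at F1
    rw [mul_comm (u 2) (u 0), mul_comm (u 2) (u 1)] at F2
    obtain ⟨k₁, k₂⟩ := stress_minors_eq hli F0 F1 F2
    have hk : u 0 * u 1 * u 2 * u 3 ≠ 0 := by positivity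
    have g₁ : a * f = c * d := by
      refine (pow_left_inj₀ (by positivity) (by positivity) three_ne_zero).mp
        (mul_left_cancel₀ hk ?_)
      linear_combination k₁
    have g₂ : b * e = c * d := by
      refine (pow_left_inj₀ (by positivity) (by positivity) three_ne_zero).mp
        (mul_left_cancel₀ hk ?_)
      linear_combination k₂
    exact u0 (eq_zero_of_potential_of_products_eq p01 p02 p03 p13 g₁ g₂ P0 P1 P2 P3)
  · obtain ⟨s, hs⟩ : ∃ s : ℝ, s • (x 1 - x 0) = x 2 - x 0 := by
      simpa [LinearIndependent.pair_iff' hx10] using hli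
    have hc : u 0 * u 3 * c ^ 3 ≠ 0 := by positivity
    have hr : x 3 - x 0 =
        (-(u 0 * u 1 * a ^ 3 + u 0 * u 2 * b ^ 3 * s) / (u 0 * u 3 * c ^ 3)) • (x 1 - x 0) := by
      have : (u 0 * u 3 * c ^ 3) • (x 3 - x 0) =
          (-(u 0 * u 1 * a ^ 3 + u 0 * u 2 * b ^ 3 * s)) • (x 1 - x 0) := by
        linear_combination (norm := module) (-1 : ℝ) • F0 + (u 0 * u 2 * b ^ 3) • hs
      rw [div_eq_inv_mul, mul_smul, ← this, inv_smul_smul₀ hc]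
    obtain ⟨i, hi⟩ := exists_eq_zero_of_force_collinear_four (o := x 0) (p := x 1 - x 0)
      (t := ![0, 1, s, -(u 0 * u 1 * a ^ 3 + u 0 * u 2 * b ^ 3 * s) / (u 0 * u 3 * c ^ 3)]) hinj
      (by
        intro i
        fin_cases i
        · simp
        · simp
        · simp [hs]
        · exact (add_sub_cancel _ _).symm.trans (congrArg _ hr)) hF
    fin_cases i <;> contradiction

lemma eq_zero_or_exists_eq_zero_of_force_collinear_three {x : Fin 3 → E} {u t : Fin 3 → ℝ}
    {o p : E} {g : ℝ}
    (hinj : Function.Injective x) (hx : ∀ i, x i = o + t i • p)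
    (hP : ∀ i, potential x u i = g) (hF : ∀ i, force x u i = 0) : g = 0 ∨ ∃ i, u i = 0 := by
  by_contra! hu
  obtain ⟨hg, hu⟩ := hu
  have hp : p ≠ 0 := by
    rintro rfl
    exact absurd (@hinj 0 1 (by rw [hx, hx]; simp)) (by decide)
  have ht : ∀ i j, i ≠ j → t i - t j ≠ 0 := fun i j hij h =>
    hij (hinj (by rw [hx, hx, sub_eq_zero.mp h]))
  have hs : ∀ i j, invSqForce (t i - t j) = -invSqForce (t j - t i) := fun i j => by
    rw [← invSqForce_neg, neg_sub]
  have f0 := force_collinear hp hx (hu 0) (hF 0)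
  have f1 := force_collinear hp hx (hu 1) (hF 1)
  have f2 := force_collinear hp hx (hu 2) (hF 2)
  have hp' : ‖p‖ ≠ 0 := norm_ne_zero_iff.mpr hp
  have hP' : ∀ i, ∑ j, u j * ((t i - t j) * invSqForce (t i - t j)) = g * ‖p‖ := fun i => by
    rw [← hP i, potential_collinear hx, div_mul_cancel₀ _ hp']
  have p0 := hP' 0
  have p1 := hP' 1
  have p2 := hP' 2
  have hz : invSqForce 0 = 0 := by simp [invSqForce]
  simp only [Fin.sum_univ_three, sub_self, hz] at f0 f1 f2 p0 p1 p2
  rw [hs 1 0] at f1 p1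
  rw [hs 2 0, hs 2 1] at f2 p2
  have total : (g * ‖p‖) * (u 0 + u 1 + u 2) = 0 := by
    linear_combination 2 * t 0 * u 0 * f0 + 2 * t 1 * u 1 * f1 + 2 * t 2 * u 2 * f2
      - u 0 * p0 - u 1 * p1 - u 2 * p2
  have total := (mul_eq_zero.mp total).resolve_left (mul_ne_zero hg hp')
  have key : u 2 * (invSqForce (t 0 - t 1) + invSqForce (t 1 - t 2)
      - invSqForce (t 0 - t 2)) = 0 := by
    linear_combination invSqForce (t 0 - t 1) * total - f0 + f1
  have e : t 0 - t 2 = (t 0 - t 1) + (t 1 - t 2) := by ring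
  refine invSqForce_add_ne (ht 0 1 (by decide)) (ht 1 2 (by decide)) ?_ ?_
  · rw [← e]
    exact ht 0 2 (by decide)
  · rw [← e]
    have := (mul_eq_zero.mp key).resolve_left (hu 2)
    linarith

lemma eq_zero_of_potential_of_force_three {x : Fin 3 → E} {u : Fin 3 → ℝ} {g : ℝ}
    (hinj : Function.Injective x) (hP : ∀ i, potential x u i = g)
    (hF : ∀ i, force x u i = 0) (i : Fin 3) : u i = 0 := by
  have hpos : ∀ i j, i ≠ j → 0 < ‖x i - x j‖⁻¹ := fun i j hij =>
    inv_pos.mpr (norm_sub_pos_iff.mpr (hinj.ne hij))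
  have p01 := hpos 0 1 (by decide)
  have p02 := hpos 0 2 (by decide)
  have p12 := hpos 1 2 (by decide)
  have P0 := hP 0
  have P1 := hP 1
  have P2 := hP 2
  have F0 := hF 0
  have F1 := hF 1
  have F2 := hF 2
  have r10 := norm_sub_rev (x 1) (x 0)
  have r20 := norm_sub_rev (x 2) (x 0)
  have r21 := norm_sub_rev (x 2) (x 1)
  simp only [potential, force, Fin.sum_univ_three, r10, r20, r21, sub_self, norm_zero,
    inv_zero, mul_zero, smul_zero, zero_add, add_zero, div_eq_mul_inv, ← inv_pow]
    at P0 P1 P2 F0 F1 F2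
  clear hpos r10 r20 r21
  generalize ‖x 0 - x 1‖⁻¹ = a at *
  generalize ‖x 0 - x 2‖⁻¹ = b at *
  generalize ‖x 1 - x 2‖⁻¹ = d at *
  suffices h : u 0 = 0 ∧ u 1 = 0 ∧ u 2 = 0 by
    obtain ⟨h0, h1, h2⟩ := h
    fin_cases i <;> assumption
  by_cases hg : g = 0
  · subst hg
    exact eq_zero_of_three_potentials p01 p02 p12 P0 P1 P2
  by_cases h0 : u 0 = 0
  · have h12 : u 1 = 0 ∨ u 2 = 0 := by
      simpa [h0, p12.ne', sub_eq_zero, hinj.eq_iff] using F1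
    rcases h12 with h | h <;> simp_all
  by_cases h1 : u 1 = 0
  · have h02 : u 2 = 0 := by
      simpa [h0, h1, p02.ne', sub_eq_zero, hinj.eq_iff] using F0
    simp_all
  by_cases h2 : u 2 = 0
  · have h01 : u 1 = 0 := by
      simpa [h0, h2, p01.ne', sub_eq_zero, hinj.eq_iff] using F0
    exact absurd h01 h1
  exfalso
  have hb : u 0 * u 2 * b ^ 3 ≠ 0 := by positivity
  have hr : x 2 - x 0 = (-(u 0 * u 1 * a ^ 3) / (u 0 * u 2 * b ^ 3)) • (x 1 - x 0) := by
    have : (u 0 * u 2 * b ^ 3) • (x 2 - x 0) = (-(u 0 * u 1 * a ^ 3)) • (x 1 - x 0) := by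
      linear_combination (norm := module) (-1 : ℝ) • F0
    rw [div_eq_inv_mul, mul_smul, ← this, inv_smul_smul₀ hb]
  rcases eq_zero_or_exists_eq_zero_of_force_collinear_three (o := x 0) (p := x 1 - x 0)
    (t := ![0, 1, -(u 0 * u 1 * a ^ 3) / (u 0 * u 2 * b ^ 3)]) hinj
    (by
      intro i
      fin_cases i
      · simp
      · simp
      · exact (add_sub_cancel _ _).symm.trans (congrArg _ hr)) hP hF with h | ⟨i, hi⟩
  · exact hg h
  · fin_cases i <;> contradiction

section Limits

variable {ι : Type*}

omit [NormedSpace ℝ E] in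
lemma tendsto_potential {κ : Type*} [Fintype κ] {l : Filter ι} {x : ι → κ → E} {u : ι → κ → ℝ}
    {y : κ → E} {v : κ → ℝ} (hy : Function.Injective y)
    (hx : ∀ i, Tendsto (fun n => x n i) l (𝓝 (y i)))
    (hu : ∀ i, Tendsto (fun n => u n i) l (𝓝 (v i))) (i : κ) :
    Tendsto (fun n => potential (x n) (u n) i) l (𝓝 (potential y v i)) := by
  refine tendsto_finsetSum _ fun j _ => ?_
  rcases eq_or_ne i j with rfl | hij
  · simpa using tendsto_const_nhds
  · exact (hu j).div ((hx i).sub (hx j)).norm (norm_sub_pos_iff.mpr (hy.ne hij)).ne'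

lemma tendsto_force {κ : Type*} [Fintype κ] {l : Filter ι} {x : ι → κ → E} {u : ι → κ → ℝ}
    {y : κ → E} {v : κ → ℝ} (hy : Function.Injective y)
    (hx : ∀ i, Tendsto (fun n => x n i) l (𝓝 (y i)))
    (hu : ∀ i, Tendsto (fun n => u n i) l (𝓝 (v i))) (i : κ) :
    Tendsto (fun n => force (x n) (u n) i) l (𝓝 (force y v i)) := by
  refine tendsto_finsetSum _ fun j _ => ?_
  rcases eq_or_ne i j with rfl | hij
  · simpa using tendsto_const_nhds
  · exact (((hu i).mul (hu j)).div (((hx i).sub (hx j)).norm.pow 3)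
      (pow_pos (norm_sub_pos_iff.mpr (hy.ne hij)) 3).ne').smul ((hx i).sub (hx j))

lemma Ultrafilter.exists_tendsto_of_bounded {F : Type*} [NormedAddCommGroup F] [ProperSpace F]
    {l : Ultrafilter ι} {f : ι → F} {C : ℝ} (h : ∀ᶠ n in l, ‖f n‖ ≤ C) :
    ∃ y, Tendsto f l (𝓝 y) := by
  obtain ⟨y, -, hy⟩ := (isCompact_closedBall (0 : F) C).ultrafilter_le_nhds (l.map f)
    (le_principal_iff.mpr <| show f ⁻¹' Metric.closedBall 0 C ∈ l by
      filter_upwards [h] with n hn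
      simpa using hn)
  exact ⟨y, hy⟩

lemma Ultrafilter.tendsto_atTop_or_bounded (l : Ultrafilter ι) (f : ι → ℝ) :
    Tendsto f l atTop ∨ ∃ C, ∀ᶠ n in l, f n ≤ C := by
  by_contra! h
  refine h.1 (tendsto_atTop.mpr fun C => ?_)
  filter_upwards [h.2 C] with n hn using hn.le

/-- Configurations of four charges, indexed along `l`, whose potentials and forces tend to zero,
while the ratios of the charges to the distances remain bounded. -/
structure AsymptoticallyBalanced (l : Filter ι) (x : ι → Fin 4 → E) (u : ι → Fin 4 → ℝ) :
    Prop where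
  inj : ∀ n, Function.Injective (x n)
  bdd : ∀ n i j, |u n j| / ‖x n i - x n j‖ ≤ 1
  potential : ∀ i, Tendsto (fun n => potential (x n) (u n) i) l (𝓝 0)
  force : ∀ i, Tendsto (fun n => force (x n) (u n) i) l (𝓝 0)

lemma norm_pair_force (a b : ℝ) (z : E) :
    ‖(a * b / ‖z‖ ^ 3) • z‖ = ‖a / ‖z‖‖ * ‖b / ‖z‖‖ := by
  simp only [norm_smul, norm_div, norm_mul, norm_pow, norm_norm]
  rcases eq_or_ne ‖z‖ 0 with h | h
  · simp [h]
  · field_simp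

omit [NormedSpace ℝ E] in
lemma potential_comp_perm {κ : Type*} [Fintype κ] (σ : Equiv.Perm κ) (x : κ → E) (u : κ → ℝ)
    (i : κ) : potential (x ∘ σ) (u ∘ σ) i = potential x u (σ i) :=
  Equiv.sum_comp σ fun j => u j / ‖x (σ i) - x j‖

lemma force_comp_perm {κ : Type*} [Fintype κ] (σ : Equiv.Perm κ) (x : κ → E) (u : κ → ℝ)
    (i : κ) : force (x ∘ σ) (u ∘ σ) i = force x u (σ i) :=
  Equiv.sum_comp σ fun j => (u (σ i) * u j / ‖x (σ i) - x j‖ ^ 3) • (x (σ i) - x j)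

namespace AsymptoticallyBalanced

variable {x : ι → Fin 4 → E} {u : ι → Fin 4 → ℝ}

lemma comp_perm {l : Filter ι} (H : AsymptoticallyBalanced l x u) (σ : Equiv.Perm (Fin 4)) :
    AsymptoticallyBalanced l (fun n => x n ∘ σ) (fun n => u n ∘ σ) where
  inj n := (H.inj n).comp σ.injective
  bdd n i j := H.bdd n (σ i) (σ j)
  potential i := by simpa only [potential_comp_perm] using H.potential (σ i)
  force i := by simpa only [force_comp_perm] using H.force (σ i)

lemma abs_le {l : Filter ι} (H : AsymptoticallyBalanced l x u) (n : ι) {i j : Fin 4}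
    (hij : i ≠ j) : |u n j| ≤ ‖x n i - x n j‖ := by
  have := (div_le_iff₀ (norm_sub_pos_iff.mpr ((H.inj n).ne hij))).mp (H.bdd n i j)
  rwa [one_mul] at this

lemma abs_div_le {l : Filter ι} (H : AsymptoticallyBalanced l x u) (n : ι) (i j : Fin 4) :
    ‖u n j / ‖x n i - x n j‖‖ ≤ 1 := by
  simpa [abs_div] using H.bdd n i j

lemma tendsto_sub_of_far {l : Filter ι} (H : AsymptoticallyBalanced l x u) {i j k : Fin 4}
    (hik : i ≠ k) (hjk : j ≠ k) {C : ℝ} (hC : ∀ᶠ n in l, ‖x n i - x n j‖ ≤ C)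
    (hk : Tendsto (fun n => ‖x n i - x n k‖) l atTop) :
    Tendsto (fun n => u n k / ‖x n j - x n k‖ - u n k / ‖x n i - x n k‖) l (𝓝 0) := by
  refine squeeze_zero_norm' ?_ ((tendsto_const_nhds (x := C)).div_atTop hk)
  filter_upwards [hC] with n hn
  have h₁ := norm_sub_pos_iff.mpr ((H.inj n).ne hik)
  have h₂ := norm_sub_pos_iff.mpr ((H.inj n).ne hjk)
  have e : u n k / ‖x n j - x n k‖ - u n k / ‖x n i - x n k‖ =
      u n k / ‖x n j - x n k‖ * ((‖x n i - x n k‖ - ‖x n j - x n k‖) / ‖x n i - x n k‖) := by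
    field_simp
  rw [e, norm_mul]
  refine (mul_le_of_le_one_left (norm_nonneg _) (H.abs_div_le n j k)).trans ?_
  rw [norm_div, norm_norm]
  gcongr
  refine le_trans (abs_norm_sub_norm_le _ _) ?_
  simpa using hn

omit [NormedSpace ℝ E] in
lemma tendsto_norm_of_far {l : Filter ι} {i j k : Fin 4} {C : ℝ}
    (hC : ∀ᶠ n in l, ‖x n i - x n j‖ ≤ C)
    (hk : Tendsto (fun n => ‖x n i - x n k‖) l atTop) :
    Tendsto (fun n => ‖x n j - x n k‖) l atTop := by
  refine tendsto_atTop_mono' l ?_ (tendsto_atTop_add_const_right l (-C) hk)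
  filter_upwards [hC] with n hn
  have := norm_sub_le_norm_sub_add_norm_sub (x n i) (x n j) (x n k)
  linarith

lemma tendsto_div_of_bounded [ProperSpace E] {l : Ultrafilter ι}
    (H : AsymptoticallyBalanced l x u) (hsep : ∀ n i j, i ≠ j → 1 ≤ ‖x n i - x n j‖)
    (hbdd : ∀ i, ∃ C, ∀ᶠ n in l, ‖x n i‖ ≤ C) (i j : Fin 4) :
    Tendsto (fun n => u n j / ‖x n i - x n j‖) l (𝓝 0) := by
  choose y hy using fun i => Ultrafilter.exists_tendsto_of_bounded (hbdd i).choose_spec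
  have hubdd : ∀ i, ∃ C, ∀ᶠ n in l, ‖u n i‖ ≤ C := by
    intro i
    obtain ⟨j, hj⟩ : ∃ j, j ≠ i := exists_ne i
    obtain ⟨C, hC⟩ := hbdd i
    obtain ⟨D, hD⟩ := hbdd j
    refine ⟨D + C, ?_⟩
    filter_upwards [hC, hD] with n hn hn'
    exact (H.abs_le n hj).trans ((norm_sub_le _ _).trans (add_le_add hn' hn))
  choose v hv using fun i => Ultrafilter.exists_tendsto_of_bounded (hubdd i).choose_spec
  have hinj : Function.Injective y := by
    intro i j hij
    by_contra hne
    have := ge_of_tendsto' ((hy i).sub (hy j)).norm fun n => hsep n i j hne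
    rw [hij, sub_self, norm_zero] at this
    linarith
  have hv0 := eq_zero_of_potential_of_force_four hinj
    (fun i => tendsto_nhds_unique (tendsto_potential hinj hy hv i) (H.potential i))
    (fun i => tendsto_nhds_unique (tendsto_force hinj hy hv i) (H.force i))
  rcases eq_or_ne i j with rfl | hij
  · simp
  · have := (hv j).div ((hy i).sub (hy j)).norm (norm_sub_pos_iff.mpr (hinj.ne hij)).ne'
    rwa [hv0, zero_div] at this

lemma tendsto_div_of_cluster [ProperSpace E] {l : Ultrafilter ι}
    (H : AsymptoticallyBalanced l x u) (hsep : ∀ n i j, i ≠ j → 1 ≤ ‖x n i - x n j‖)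
    (hbdd : ∀ i : Fin 3, ∃ C, ∀ᶠ n in l, ‖x n i.castSucc‖ ≤ C)
    (hfar : Tendsto (fun n => ‖x n 0 - x n 3‖) l atTop) (i j : Fin 4) :
    Tendsto (fun n => u n j / ‖x n i - x n j‖) l (𝓝 0) := by
  choose y hy using fun i => Ultrafilter.exists_tendsto_of_bounded (hbdd i).choose_spec
  have hubdd : ∀ i : Fin 3, ∃ C, ∀ᶠ n in l, ‖u n i.castSucc‖ ≤ C := by
    intro i
    obtain ⟨j, hj⟩ : ∃ j, j ≠ i := exists_ne i
    obtain ⟨C, hC⟩ := hbdd i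
    obtain ⟨D, hD⟩ := hbdd j
    refine ⟨D + C, ?_⟩
    filter_upwards [hC, hD] with n hn hn'
    exact (H.abs_le n ((Fin.castSucc_injective 3).ne hj)).trans
      ((norm_sub_le _ _).trans (add_le_add hn' hn))
  choose v hv using fun i => Ultrafilter.exists_tendsto_of_bounded (hubdd i).choose_spec
  have hinj : Function.Injective y := by
    intro i j hij
    by_contra hne
    have := ge_of_tendsto' ((hy i).sub (hy j)).norm
      fun n => hsep n _ _ ((Fin.castSucc_injective 3).ne hne)
    rw [hij, sub_self, norm_zero] at this
    linarith
  have hnear : ∀ i : Fin 3, ∃ C, ∀ᶠ n in l, ‖x n 0 - x n i.castSucc‖ ≤ C := by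
    intro i
    obtain ⟨C, hC⟩ := hbdd 0
    obtain ⟨D, hD⟩ := hbdd i
    refine ⟨C + D, ?_⟩
    filter_upwards [hC, hD] with n hn hn'
    exact (norm_sub_le _ _).trans (add_le_add hn hn')
  have hfar' : ∀ i : Fin 3, Tendsto (fun n => ‖x n i.castSucc - x n 3‖) l atTop := fun i =>
    tendsto_norm_of_far (hnear i).choose_spec hfar
  obtain ⟨q, hq⟩ := Ultrafilter.exists_tendsto_of_bounded (l := l) (.of_forall
    fun n => H.abs_div_le n 0 3)
  have hq' : ∀ i : Fin 3, Tendsto (fun n => u n 3 / ‖x n i.castSucc - x n 3‖) l (𝓝 q) := by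
    intro i
    simpa using (H.tendsto_sub_of_far (by decide) (Fin.castSucc_lt_last i).ne
      (hnear i).choose_spec hfar).add hq
  have hy0 : ∀ i : Fin 3, Tendsto (fun n => u n i.castSucc / ‖x n i.castSucc - x n 3‖) l (𝓝 0) :=
    fun i => (hv i).div_atTop (hfar' i)
  have hpot : ∀ i, _root_.potential y v i = -q := by
    intro i
    have h₁ := (tendsto_potential hinj hy hv i).add (hq' i)
    have h₂ := H.potential i.castSucc
    simp only [_root_.potential, Fin.sum_univ_castSucc (n := 3)] at h₁ h₂
    exact eq_neg_of_add_eq_zero_left (tendsto_nhds_unique h₁ h₂)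
  have hforce : ∀ i, _root_.force y v i = 0 := by
    intro i
    have h₀ : Tendsto (fun n => (u n i.castSucc * u n 3 / ‖x n i.castSucc - x n 3‖ ^ 3) •
        (x n i.castSucc - x n 3)) l (𝓝 0) := by
      have h := (hy0 i).norm
      rw [norm_zero] at h
      refine squeeze_zero_norm (fun n => ?_) h
      rw [norm_pair_force]
      exact mul_le_of_le_one_right (norm_nonneg _) (H.abs_div_le n _ 3)
    have h₁ := (tendsto_force hinj hy hv i).add h₀
    have h₂ := H.force i.castSucc
    simp only [_root_.force, Fin.sum_univ_castSucc (n := 3)] at h₁ h₂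
    rw [add_zero] at h₁
    exact tendsto_nhds_unique h₁ h₂
  have hv0 := eq_zero_of_potential_of_force_three hinj hpot hforce
  have hq0 : q = 0 := by
    have := hpot 0
    simp only [_root_.potential, hv0, zero_div, Finset.sum_const_zero] at this
    linarith
  subst hq0
  induction i using Fin.lastCases with
  | last =>
    induction j using Fin.lastCases with
    | last => simp
    | cast j =>
      refine (hy0 j).congr fun n => ?_
      rw [norm_sub_rev]
      rfl
  | cast i =>
    induction j using Fin.lastCases with
    | last => exact hq' i
    | cast j =>
      rcases eq_or_ne i j with rfl | hij
      · simp
      · have := (hv j).div ((hy i).sub (hy j)).norm (norm_sub_pos_iff.mpr (hinj.ne hij)).ne'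
        rwa [hv0, zero_div] at this

lemma tendsto_div_of_pair {l : Ultrafilter ι} (H : AsymptoticallyBalanced l x u)
    (h01 : ∀ n, ‖x n 0 - x n 1‖ = 1)
    (hfar₂ : Tendsto (fun n => ‖x n 0 - x n 2‖) l atTop)
    (hfar₃ : Tendsto (fun n => ‖x n 0 - x n 3‖) l atTop) (i j : Fin 4) :
    Tendsto (fun n => u n j / ‖x n i - x n j‖) l (𝓝 0) := by
  have h01' : ∀ᶠ n in l, ‖x n 0 - x n 1‖ ≤ 1 := .of_forall fun n => (h01 n).le
  have h10 : ∀ n, ‖x n 1 - x n 0‖ = 1 := fun n => by rw [norm_sub_rev, h01]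
  have hfar₂' := tendsto_norm_of_far h01' hfar₂
  have hfar₃' := tendsto_norm_of_far h01' hfar₃
  have d₂ := H.tendsto_sub_of_far (by decide) (by decide) h01' hfar₂
  have d₃ := H.tendsto_sub_of_far (by decide) (by decide) h01' hfar₃
  have hu0 : ∀ n, |u n 0| ≤ 1 := fun n => (H.abs_le n (i := 1) (by decide)).trans (h10 n).le
  have hu1 : ∀ n, |u n 1| ≤ 1 := fun n => (H.abs_le n (i := 0) (by decide)).trans (h01 n).le
  have small : ∀ {i j k : Fin 4}, (∀ n, |u n k| ≤ 1) →
      Tendsto (fun n => ‖x n i - x n j‖) l atTop →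
      Tendsto (fun n => u n k / ‖x n i - x n j‖) l (𝓝 0) := by
    intro i j k hk h
    refine squeeze_zero_norm (fun n => ?_) ((tendsto_const_nhds (x := (1 : ℝ))).div_atTop h)
    rw [norm_div, norm_norm]
    gcongr
    exact hk n
  have s₀₂ := small hu0 hfar₂
  have s₀₃ := small hu0 hfar₃
  have s₁₂ := small hu1 hfar₂'
  have s₁₃ := small hu1 hfar₃'
  have w₃ : Tendsto (fun n => u n 3 / ‖x n 2 - x n 3‖) l (𝓝 0) := by
    have h := ((H.potential 2).sub s₀₂).sub s₁₂
    simp only [sub_zero] at h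
    refine h.congr fun n => ?_
    simp only [_root_.potential, Fin.sum_univ_four, sub_self, norm_zero, div_zero,
      norm_sub_rev (x n 2) (x n 0), norm_sub_rev (x n 2) (x n 1)]
    ring
  have w₂ : Tendsto (fun n => u n 2 / ‖x n 2 - x n 3‖) l (𝓝 0) := by
    have h := ((H.potential 3).sub s₀₃).sub s₁₃
    simp only [sub_zero] at h
    refine h.congr fun n => ?_
    simp only [_root_.potential, Fin.sum_univ_four, sub_self, norm_zero, div_zero,
      norm_sub_rev (x n 3)]
    ring
  have p₀ : Tendsto (fun n => u n 1 + u n 2 / ‖x n 0 - x n 2‖ + u n 3 / ‖x n 0 - x n 3‖) l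
      (𝓝 0) := by
    refine (H.potential 0).congr fun n => ?_
    simp [_root_.potential, Fin.sum_univ_four, h01]
  have hsub : Tendsto (fun n => u n 0 - u n 1) l (𝓝 0) := by
    have h := (((H.potential 1).sub p₀).sub d₂).sub d₃
    simp only [sub_zero] at h
    refine h.congr fun n => ?_
    simp only [_root_.potential, Fin.sum_univ_four, sub_self, norm_zero, div_zero, h10]
    ring
  have hmul : Tendsto (fun n => u n 0 * u n 1) l (𝓝 0) := by
    have force_far : ∀ {k : Fin 4}, Tendsto (fun n => u n 0 / ‖x n 0 - x n k‖) l (𝓝 0) →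
        Tendsto (fun n => (u n 0 * u n k / ‖x n 0 - x n k‖ ^ 3) • (x n 0 - x n k)) l (𝓝 0) := by
      intro k hk
      have h := hk.norm
      rw [norm_zero] at h
      refine squeeze_zero_norm (fun n => ?_) h
      rw [norm_pair_force]
      exact mul_le_of_le_one_right (norm_nonneg _) (H.abs_div_le n 0 k)
    have h := ((H.force 0).sub (force_far s₀₂)).sub (force_far s₀₃)
    simp only [sub_zero] at h
    refine squeeze_zero_norm (fun n => ?_) (by simpa only [norm_zero] using h.norm)
    have e : _root_.force (x n) (u n) 0
        - (u n 0 * u n 2 / ‖x n 0 - x n 2‖ ^ 3) • (x n 0 - x n 2)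
        - (u n 0 * u n 3 / ‖x n 0 - x n 3‖ ^ 3) • (x n 0 - x n 3)
        = (u n 0 * u n 1) • (x n 0 - x n 1) := by
      simp only [_root_.force, Fin.sum_univ_four, sub_self, smul_zero, h01]
      module
    rw [e, norm_smul, h01, mul_one]
  have hz0 : Tendsto (fun n => u n 0) l (𝓝 0) := by
    have hm : Tendsto (fun n => u n 0 * (u n 0 - u n 1)) l (𝓝 0) := by
      refine squeeze_zero_norm (fun n => ?_) (by simpa only [norm_zero] using hsub.norm)
      rw [norm_mul]
      exact mul_le_of_le_one_left (norm_nonneg _) (hu0 n)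
    have hsq : Tendsto (fun n => u n 0 ^ 2) l (𝓝 0) := by
      have := hmul.add hm
      rw [add_zero] at this
      exact this.congr fun n => by ring
    refine tendsto_zero_iff_abs_tendsto_zero _ |>.mpr ?_
    have := hsq.sqrt
    simp only [Real.sqrt_sq_eq_abs, Real.sqrt_zero] at this
    exact this
  have hz1 : Tendsto (fun n => u n 1) l (𝓝 0) := by simpa using hz0.sub hsub
  have hsum : Tendsto (fun n => u n 2 / ‖x n 0 - x n 2‖ + u n 3 / ‖x n 0 - x n 3‖) l (𝓝 0) := by
    have := p₀.sub hz1
    rw [sub_zero] at this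
    exact this.congr fun n => by ring
  have compare : ∀ {j k : Fin 4}, (∀ᶠ n in l, ‖x n 0 - x n j‖ ≤ ‖x n 0 - x n k‖) → 0 ≠ k →
      j ≠ k → Tendsto (fun n => u n k / ‖x n j - x n k‖) l (𝓝 0) →
      Tendsto (fun n => u n k / ‖x n 0 - x n k‖) l (𝓝 0) := by
    intro j k hjk h0k hne h
    refine squeeze_zero_norm' ?_ (by simpa only [norm_zero, mul_zero] using h.norm.const_mul 2)
    filter_upwards [hjk] with n hn
    have h₁ := norm_sub_pos_iff.mpr ((H.inj n).ne h0k)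
    have h₂ := norm_sub_pos_iff.mpr ((H.inj n).ne hne)
    have h₃ := norm_sub_le_norm_sub_add_norm_sub (x n j) (x n 0) (x n k)
    rw [norm_sub_rev (x n j) (x n 0)] at h₃
    rw [norm_div, norm_div, norm_norm, norm_norm, ← mul_div_assoc, div_le_div_iff₀ h₁ h₂]
    nlinarith [norm_nonneg (u n k)]
  have hz : Tendsto (fun n => u n 2 / ‖x n 0 - x n 2‖) l (𝓝 0) ∧
      Tendsto (fun n => u n 3 / ‖x n 0 - x n 3‖) l (𝓝 0) := by
    rcases Ultrafilter.eventually_or.mp (Eventually.of_forall (f := (l : Filter ι)) fun n =>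
      le_total ‖x n 0 - x n 2‖ ‖x n 0 - x n 3‖) with h | h
    · have h3 := compare h (by decide) (by decide) w₃
      exact ⟨by simpa using hsum.sub h3, h3⟩
    · have h2 := compare h (by decide) (by decide) (by simpa only [norm_sub_rev] using w₂)
      exact ⟨h2, by simpa using hsum.sub h2⟩
  obtain ⟨w₀₂, w₀₃⟩ := hz
  have w₁₂ : Tendsto (fun n => u n 2 / ‖x n 1 - x n 2‖) l (𝓝 0) := by simpa using d₂.add w₀₂
  have w₁₃ : Tendsto (fun n => u n 3 / ‖x n 1 - x n 3‖) l (𝓝 0) := by simpa using d₃.add w₀₃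
  have symm : ∀ {i j k : Fin 4}, Tendsto (fun n => u n k / ‖x n i - x n j‖) l (𝓝 0) →
      Tendsto (fun n => u n k / ‖x n j - x n i‖) l (𝓝 0) :=
    fun h => h.congr fun n => by rw [norm_sub_rev]
  have diag : ∀ {i : Fin 4}, Tendsto (fun n => u n i / ‖x n i - x n i‖) l (𝓝 0) := by simp
  have z₀₁ : Tendsto (fun n => u n 1 / ‖x n 0 - x n 1‖) l (𝓝 0) := by simpa [h01] using hz1
  have z₁₀ : Tendsto (fun n => u n 0 / ‖x n 1 - x n 0‖) l (𝓝 0) := by simpa [h10] using hz0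
  fin_cases i <;> fin_cases j
  exacts [diag, z₀₁, w₀₂, w₀₃, z₁₀, diag, w₁₂, w₁₃, symm s₀₂, symm s₁₂, diag, w₃,
    symm s₀₃, symm s₁₃, symm w₂, diag]

lemma tendsto_div [ProperSpace E] {l : Ultrafilter ι} (H : AsymptoticallyBalanced l x u)
    (h0 : ∀ n, x n 0 = 0) (h01 : ∀ n, ‖x n 0 - x n 1‖ = 1)
    (hsep : ∀ n i j, i ≠ j → 1 ≤ ‖x n i - x n j‖) (i j : Fin 4) :
    Tendsto (fun n => u n j / ‖x n i - x n j‖) l (𝓝 0) := by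
  have b₀ : ∃ C, ∀ᶠ n in l, ‖x n 0‖ ≤ C := ⟨0, .of_forall fun n => by simp [h0]⟩
  have b₁ : ∃ C, ∀ᶠ n in l, ‖x n 1‖ ≤ C :=
    ⟨1, .of_forall fun n => by simpa [h0] using (h01 n).le⟩
  have hb : ∀ k, (∃ C, ∀ᶠ n in l, ‖x n 0 - x n k‖ ≤ C) → ∃ C, ∀ᶠ n in l, ‖x n k‖ ≤ C := by
    rintro k ⟨C, hC⟩
    refine ⟨C, ?_⟩
    filter_upwards [hC] with n hn
    simpa [h0] using hn
  rcases l.tendsto_atTop_or_bounded (fun n => ‖x n 0 - x n 2‖) with h₂ | h₂ <;>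
    rcases l.tendsto_atTop_or_bounded (fun n => ‖x n 0 - x n 3‖) with h₃ | h₃
  · exact H.tendsto_div_of_pair h01 h₂ h₃ i j
  · have := (H.comp_perm (Equiv.swap 2 3)).tendsto_div_of_cluster
      (fun n i j hij => hsep n _ _ ((Equiv.swap 2 3).injective.ne hij))
      (by
        intro i
        fin_cases i
        exacts [b₀, b₁, hb 3 h₃]) h₂ (Equiv.swap 2 3 i) (Equiv.swap 2 3 j)
    simpa using this
  · exact H.tendsto_div_of_cluster hsep (by
      intro i
      fin_cases i
      exacts [b₀, b₁, hb 2 h₂]) h₃ i j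
  · exact H.tendsto_div_of_bounded hsep (by
      intro i
      fin_cases i
      exacts [b₀, b₁, hb 2 h₂, hb 3 h₃]) i j

end AsymptoticallyBalanced

end Limits

omit [NormedSpace ℝ E] in
lemma potential_const_mul {κ : Type*} [Fintype κ] (x : κ → E) (u : κ → ℝ) (c : ℝ) (i : κ) :
    potential x (fun j => c * u j) i = c * potential x u i := by
  simp only [potential, Finset.mul_sum, mul_div_assoc]

lemma force_const_mul {κ : Type*} [Fintype κ] (x : κ → E) (u : κ → ℝ) (c : ℝ) (i : κ) :
    force x (fun j => c * u j) i = c ^ 2 • force x u i := by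
  simp only [force, Finset.smul_sum, smul_smul]
  refine Finset.sum_congr rfl fun j _ => ?_
  congr 1
  ring

lemma norm_smul_sub_sub {c : ℝ} (hc : 0 < c) (a b o : E) :
    ‖c • (a - o) - c • (b - o)‖ = c * ‖a - b‖ := by
  rw [← smul_sub, sub_sub_sub_cancel_right, norm_smul, Real.norm_of_nonneg hc.le]

lemma potential_rescale {κ : Type*} [Fintype κ] (x : κ → E) (u : κ → ℝ) {c : ℝ} (hc : 0 < c)
    (o : E) (i : κ) :
    potential (fun j => c • (x j - o)) (fun j => c * u j) i = potential x u i := by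
  refine Finset.sum_congr rfl fun j _ => ?_
  rw [norm_smul_sub_sub hc, mul_div_mul_left _ _ hc.ne']

lemma force_rescale {κ : Type*} [Fintype κ] (x : κ → E) (u : κ → ℝ) {c : ℝ} (hc : 0 < c)
    (o : E) (i : κ) :
    force (fun j => c • (x j - o)) (fun j => c * u j) i = force x u i := by
  refine Finset.sum_congr rfl fun j _ => ?_
  rw [norm_smul_sub_sub hc, ← smul_sub, sub_sub_sub_cancel_right, smul_smul]
  congr 1
  have := hc.ne'
  rw [mul_pow, div_mul_eq_mul_div, show c * u i * (c * u j) * c = c ^ 3 * (u i * u j) by ring,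
    mul_div_mul_left _ _ (pow_ne_zero 3 this)]

lemma exists_uniform_bound_normalized [ProperSpace E] {δ : ℝ} (hδ : 0 < δ) :
    ∃ ε > 0, ∀ (x : Fin 4 → E) (u : Fin 4 → ℝ), x 0 = 0 → ‖x 0 - x 1‖ = 1 →
      (∀ i j, i ≠ j → 1 ≤ ‖x i - x j‖) → (∀ i j, |u j| / ‖x i - x j‖ ≤ 1) →
      (∀ i, |potential x u i| ≤ ε) → (∀ i, ‖force x u i‖ ≤ ε) →
      ∀ i j, |u j| / ‖x i - x j‖ ≤ δ := by
  by_contra! h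
  have hpos : ∀ n : ℕ, (0 : ℝ) < 1 / (n + 1) := fun n => by positivity
  choose x u h0 h01 hsep hbdd hP hF i j hij using fun n : ℕ => h _ (hpos n)
  have hle : ((hyperfilter ℕ : Ultrafilter ℕ) : Filter ℕ) ≤ atTop := by
    rw [← Nat.cofinite_eq_atTop]
    exact hyperfilter_le_cofinite
  have hlim := (tendsto_one_div_add_atTop_nhds_zero_nat (𝕜 := ℝ)).mono_left hle
  have H : AsymptoticallyBalanced (hyperfilter ℕ : Ultrafilter ℕ) x u :=
    { inj := fun n a b hab => by
        by_contra hne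
        have := hsep n a b hne
        rw [hab, sub_self, norm_zero] at this
        linarith
      bdd := hbdd
      potential := fun i => squeeze_zero_norm (fun n => hP n i) hlim
      force := fun i => squeeze_zero_norm (fun n => hF n i) hlim }
  have hev : ∀ᶠ n in (hyperfilter ℕ : Ultrafilter ℕ), ∀ i j, |u n j| / ‖x n i - x n j‖ < δ := by
    refine eventually_all.mpr fun i => eventually_all.mpr fun j => ?_
    have := (H.tendsto_div h0 h01 hsep i j).norm
    rw [norm_zero] at this
    filter_upwards [this.eventually_lt_const hδ] with n hn
    simpa [abs_div] using hn
  obtain ⟨n, hn⟩ := hev.exists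
  exact absurd (hn (i n) (j n)) (hij n).not_gt

omit [NormedSpace ℝ E] in
lemma exists_perm_closest_pair (x : Fin 4 → E) : ∃ σ : Equiv.Perm (Fin 4),
    ∀ i j, i ≠ j → ‖x (σ 0) - x (σ 1)‖ ≤ ‖x i - x j‖ := by
  obtain ⟨⟨a, b⟩, hab, hmin⟩ := (Finset.univ : Finset (Fin 4)).offDiag.exists_min_image
    (fun p => ‖x p.1 - x p.2‖) ⟨(0, 1), by simp⟩
  have hne : a ≠ b := (Finset.mem_offDiag.mp hab).2.2
  obtain ⟨σ, h0, h1⟩ : ∃ σ : Equiv.Perm (Fin 4), σ 0 = a ∧ σ 1 = b := by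
    clear hab hmin
    revert a b
    decide
  refine ⟨σ, fun i j hij => ?_⟩
  rw [h0, h1]
  exact hmin (i, j) (by simpa using hij)

lemma exists_uniform_bound [ProperSpace E] {δ : ℝ} (hδ : 0 < δ) :
    ∃ ε > 0, ∀ (x : Fin 4 → E) (u : Fin 4 → ℝ), Function.Injective x →
      (∀ i j, |u j| / ‖x i - x j‖ ≤ 1) →
      (∀ i, |potential x u i| ≤ ε) → (∀ i, ‖force x u i‖ ≤ ε) →
      ∀ i j, |u j| / ‖x i - x j‖ ≤ δ := by
  obtain ⟨ε, hε, h⟩ := exists_uniform_bound_normalized (E := E) hδ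
  refine ⟨ε, hε, fun x u hx hbdd hP hF i j => ?_⟩
  obtain ⟨σ, hσ⟩ := exists_perm_closest_pair x
  have hr : 0 < ‖x (σ 0) - x (σ 1)‖ := norm_sub_pos_iff.mpr ((hx.comp σ.injective).ne (by decide))
  have hc := inv_pos.mpr hr
  have ratio : ∀ k l, |‖x (σ 0) - x (σ 1)‖⁻¹ * u (σ l)| /
      ‖‖x (σ 0) - x (σ 1)‖⁻¹ • (x (σ k) - x (σ 0)) - ‖x (σ 0) - x (σ 1)‖⁻¹ • (x (σ l) - x (σ 0))‖
        = |u (σ l)| / ‖x (σ k) - x (σ l)‖ := fun k l => by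
    rw [norm_smul_sub_sub hc, abs_mul, abs_of_pos hc, mul_div_mul_left _ _ hc.ne']
  have key := h (fun k => ‖x (σ 0) - x (σ 1)‖⁻¹ • ((x ∘ σ) k - x (σ 0)))
    (fun k => ‖x (σ 0) - x (σ 1)‖⁻¹ * (u ∘ σ) k) (by simp)
    (by
      rw [norm_smul_sub_sub hc]
      exact inv_mul_cancel₀ hr.ne')
    (by
      intro k l hkl
      rw [norm_smul_sub_sub hc, inv_mul_eq_div, one_le_div hr]
      exact hσ _ _ (σ.injective.ne hkl))
    (fun k l => (ratio k l).trans_le (hbdd _ _))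
    (fun k => by rw [potential_rescale _ _ hc, potential_comp_perm]; exact hP _)
    (fun k => by rw [force_rescale _ _ hc, force_comp_perm]; exact hF _) (σ.symm i) (σ.symm j)
  have := (ratio (σ.symm i) (σ.symm j)).symm.trans_le key
  simpa using this

lemma exists_coercivity [ProperSpace E] :
    ∃ c > 0, ∀ (x : Fin 4 → E) (u : Fin 4 → ℝ), Function.Injective x →
      ∀ L : ℝ, (∀ i, potential x u i ^ 2 ≤ L) → (∀ i, ‖force x u i‖ ≤ L) →
        c * ∑ i, ∑ j, u j ^ 2 / ‖x i - x j‖ ^ 2 ≤ L := by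
  obtain ⟨ε, hε, h⟩ := exists_uniform_bound (E := E) (δ := 1 / 8) (by norm_num)
  refine ⟨min ε (ε ^ 2), by positivity, fun x u hx L hP hF => ?_⟩
  set S := ∑ i, ∑ j, u j ^ 2 / ‖x i - x j‖ ^ 2 with hS
  by_contra! hL
  have hL0 : 0 ≤ L := (sq_nonneg _).trans (hP 0)
  have hSpos : 0 < S := by
    have := hL0.trans_lt hL
    exact pos_of_mul_pos_right this (by positivity)
  have hM : 0 < √S := Real.sqrt_pos.mpr hSpos
  have hc : 0 < (√S)⁻¹ := inv_pos.mpr hM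
  have hcS : (√S)⁻¹ ^ 2 = S⁻¹ := by rw [inv_pow, Real.sq_sqrt hSpos.le]
  have hLS : S⁻¹ * L ≤ min ε (ε ^ 2) := by
    rw [inv_mul_le_iff₀ hSpos, mul_comm]
    exact hL.le
  have hterm : ∀ i j, (|(√S)⁻¹ * u j| / ‖x i - x j‖) ^ 2 =
      S⁻¹ * (u j ^ 2 / ‖x i - x j‖ ^ 2) := fun i j => by
    rw [div_pow, sq_abs, mul_pow, hcS, mul_div_assoc]
  have hsum : ∑ i, ∑ j, (|(√S)⁻¹ * u j| / ‖x i - x j‖) ^ 2 = 1 := by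
    simp only [hterm, ← Finset.mul_sum]
    exact inv_mul_cancel₀ hSpos.ne'
  have key := h x (fun j => (√S)⁻¹ * u j) hx
    (fun i j => by
      refine (sq_le_one_iff₀ (by positivity)).mp ?_
      rw [← hsum]
      refine le_trans ?_ (Finset.single_le_sum
        (f := fun i => ∑ j, (|(√S)⁻¹ * u j| / ‖x i - x j‖) ^ 2)
        (fun _ _ => by positivity) (Finset.mem_univ i))
      exact Finset.single_le_sum (f := fun j => (|(√S)⁻¹ * u j| / ‖x i - x j‖) ^ 2)
        (fun _ _ => by positivity) (Finset.mem_univ j))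
    (fun i => by
      refine abs_le_of_sq_le_sq ?_ hε.le
      rw [potential_const_mul, mul_pow, hcS]
      exact (mul_le_mul_of_nonneg_left (hP i) (by positivity)).trans (hLS.trans (min_le_right _ _)))
    (fun i => by
      rw [force_const_mul, hcS, norm_smul, Real.norm_of_nonneg (by positivity)]
      exact (mul_le_mul_of_nonneg_left (hF i) (by positivity)).trans (hLS.trans (min_le_left _ _)))
  have hsmall : ∑ i : Fin 4, ∑ j : Fin 4, (|(√S)⁻¹ * u j| / ‖x i - x j‖) ^ 2 ≤
      ∑ i : Fin 4, ∑ j : Fin 4, (1 / 8 : ℝ) ^ 2 := by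
    exact Finset.sum_le_sum fun i _ => Finset.sum_le_sum fun j _ =>
      pow_le_pow_left₀ (by positivity) (key i j) 2
  rw [hsum] at hsmall
  norm_num at hsmall

lemma Finset.sum_univ_sdiff_singleton {κ M : Type*} [Fintype κ] [DecidableEq κ] [AddCommMonoid M]
    {f : κ → M} {i : κ} (h : f i = 0) : ∑ j ∈ univ \ {i}, f j = ∑ j, f j := by
  rw [Finset.sdiff_singleton_eq_erase, Finset.sum_erase _ h]

open Finset in
theorem stmt_19 (m : ℕ) :
    ∃ c > 0, ∀ x : Fin 4 → EuclideanSpace ℝ (Fin m), Function.Injective x →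
      ∀ u : Fin 4 → ℝ,
        (∑ i, (∑ j ∈ univ \ {i}, u j / ‖x i - x j‖) ^ 2) +
          2 * (univ.sup' univ_nonempty fun i =>
            ‖∑ j ∈ univ \ {i}, (u i * u j / ‖x i - x j‖ ^ 3) • (x i - x j)‖)
        ≥ c * ∑ i, ∑ j ∈ univ \ {i}, (u j) ^ 2 / ‖x i - x j‖ ^ 2 := by
  obtain ⟨c, hc, h⟩ := exists_coercivity (E := EuclideanSpace ℝ (Fin m))
  refine ⟨c, hc, fun x hx u => ?_⟩
  have e₁ : ∀ i, ∑ j ∈ univ \ {i}, u j / ‖x i - x j‖ = potential x u i := fun i =>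
    sum_univ_sdiff_singleton (by simp)
  have e₂ : ∀ i, ∑ j ∈ univ \ {i}, (u i * u j / ‖x i - x j‖ ^ 3) • (x i - x j) = force x u i :=
    fun i => sum_univ_sdiff_singleton (by simp)
  have e₃ : ∀ i, ∑ j ∈ univ \ {i}, u j ^ 2 / ‖x i - x j‖ ^ 2 = ∑ j, u j ^ 2 / ‖x i - x j‖ ^ 2 :=
    fun i => sum_univ_sdiff_singleton (by simp)
  simp only [e₁, e₂, e₃]
  have hsup : ∀ i, ‖force x u i‖ ≤ univ.sup' univ_nonempty fun i => ‖force x u i‖ := fun i =>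
    le_sup' (fun i => ‖force x u i‖) (mem_univ i)
  have hsq : ∀ i, potential x u i ^ 2 ≤ ∑ i, potential x u i ^ 2 := fun i =>
    single_le_sum (f := fun i => potential x u i ^ 2) (fun _ _ => sq_nonneg _) (mem_univ i)
  have hsup0 := (norm_nonneg _).trans (hsup 0)
  have hsq0 := (sq_nonneg _).trans (hsq 0)
  exact h x u hx _ (fun i => by linarith [hsq i]) (fun i => by linarith [hsup i])
end
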